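/- Let (f,C) be a low-defect pair of degree k, and let a be the leading coefficient of f. Then δ(f,C) ≥ δ(a) + k ≥ k, where δ(a) = ‖a‖ − 3·log₃ a is the defect of the positive integer a. -/

import Mathlib

/-- `CpxW n k` : the positive integer `n` can be written using exactly `k` ones,
with an arbitrary combination of additions and multiplications. -/
inductive CpxW : ℕ → ℕ → Prop
  | one : CpxW 1 1
  | add {a b m n : ℕ} : CpxW a m → CpxW b n → CpxW (a + b) (m + n)
  | mul {a b m n : ℕ} : CpxW a m → CpxW b n → CpxW (a * b) (m + n)

/-- The integer complexity `‖n‖`: the least number of 1's needed to write `n`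
using additions and multiplications. -/
noncomputable def cpx (n : ℕ) : ℕ := sInf {k | CpxW n k}

/-- The defect `δ(n) = ‖n‖ - 3 log₃ n`. -/
noncomputable def defect (n : ℕ) : ℝ := (cpx n : ℝ) - 3 * Real.logb 3 (n : ℝ)

/-- `LDP r f C` : `(f, C)` is a low-defect pair of degree `r`; here a low-defect
polynomial of degree `r` is written in the variables `X 0, …, X (r-1)`. -/
inductive LDP : ℕ → MvPolynomial ℕ ℤ → ℕ → Prop
  | const (k C : ℕ) (hk : 0 < k) (hC : cpx k ≤ C) :
      LDP 0 (MvPolynomial.C (k : ℤ)) C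
  | mul {r₁ r₂ : ℕ} {f₁ f₂ : MvPolynomial ℕ ℤ} {C₁ C₂ : ℕ} :
      LDP r₁ f₁ C₁ → LDP r₂ f₂ C₂ →
      LDP (r₁ + r₂) (f₁ * MvPolynomial.rename (· + r₁) f₂) (C₁ + C₂)
  | step {r : ℕ} {f : MvPolynomial ℕ ℤ} {C : ℕ} (c D : ℕ) (hc : 0 < c) (hD : cpx c ≤ D) :
      LDP r f C → LDP (r + 1) (f * MvPolynomial.X r + MvPolynomial.C (c : ℤ)) (C + D)

/-- A low-defect polynomial: the first component of some low-defect pair. -/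
def LowDefectPoly (f : MvPolynomial ℕ ℤ) : Prop := ∃ r C, LDP r f C

/-- The leading coefficient of a low-defect polynomial of degree `r`:
the coefficient of `x₁ ⋯ x_r`. -/
noncomputable def leadCoeff (r : ℕ) (f : MvPolynomial ℕ ℤ) : ℤ :=
  MvPolynomial.coeff (∑ i ∈ Finset.range r, Finsupp.single i 1) f

/-- The defect `δ(f,C) = C - 3 log₃ a` of a low-defect pair of degree `r`,
where `a` is the leading coefficient. -/
noncomputable def pairDft (r : ℕ) (f : MvPolynomial ℕ ℤ) (C : ℕ) : ℝ :=
  (C : ℝ) - 3 * Real.logb 3 ((leadCoeff r f : ℤ) : ℝ)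

/-- `f(3^{k₁}, …, 3^{k_r})` for a polynomial of degree `r`. -/
noncomputable def eval3 (r : ℕ) (f : MvPolynomial ℕ ℤ) (k : ℕ → ℕ) : ℤ :=
  MvPolynomial.eval (fun i => if i < r then (3 : ℤ) ^ (k i) else 1) f

/-- `δ_{f,C}(k₁,…,k_r) = C + 3(k₁+⋯+k_r) - 3 log₃ f(3^{k₁},…,3^{k_r})`. -/
noncomputable def dftF (r : ℕ) (f : MvPolynomial ℕ ℤ) (C : ℕ) (k : ℕ → ℕ) : ℝ :=
  (C : ℝ) + 3 * (∑ i ∈ Finset.range r, (k i : ℝ))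
    - 3 * Real.logb 3 ((eval3 r f k : ℤ) : ℝ)

/-- The nesting order: `NestLe f i j` means `xᵢ ⪯ xⱼ`, i.e. every monomial of `f`
divisible by `xᵢ` is divisible by `xⱼ`. -/
def NestLe (f : MvPolynomial ℕ ℤ) (i j : ℕ) : Prop :=
  ∀ m ∈ f.support, m i ≠ 0 → m j ≠ 0

/-- `xᵢ` is a variable of (the degree-`r` polynomial) `f` that is minimal with
respect to the nesting order. -/
def IsMinVar (r : ℕ) (f : MvPolynomial ℕ ℤ) (i : ℕ) : Prop :=
  i < r ∧ ∀ j < r, NestLe f j i → NestLe f i j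

/-- Substituting `3^k` for the variable `xᵢ` of `f`, renumbering the later
variables down by one. -/
noncomputable def truncAt (f : MvPolynomial ℕ ℤ) (i k : ℕ) : MvPolynomial ℕ ℤ :=
  MvPolynomial.aeval (fun j => if j < i then MvPolynomial.X j
    else if j = i then MvPolynomial.C ((3 : ℤ) ^ k) else MvPolynomial.X (j - 1)) f

/-- A direct truncation of a "pair with degree" `(r, f, C)`: substitute `3^k`
into a variable of `f` minimal in the nesting order. -/
def DirectTrunc (a b : ℕ × MvPolynomial ℕ ℤ × ℕ) : Prop :=
  ∃ i k : ℕ, a.1 = b.1 + 1 ∧ IsMinVar a.1 a.2.1 i ∧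
    b.2.1 = truncAt a.2.1 i k ∧ b.2.2 = a.2.2 + 3 * k

/-- `n` is a leader: either `3 ∤ n`, or `3 ∣ n` and `‖n‖ < ‖n/3‖ + 3`. -/
def IsLeader (n : ℕ) : Prop := 0 < n ∧ (3 ∣ n → cpx n < cpx (n / 3) + 3)

/-- `(f, C)` (of degree `r`) efficiently 3-represents `n`. -/
def EffRep (r : ℕ) (f : MvPolynomial ℕ ℤ) (C : ℕ) (n : ℕ) : Prop :=
  ∃ k : ℕ → ℕ, (n : ℤ) = eval3 r f k ∧ cpx n = C + 3 * ∑ i ∈ Finset.range r, k i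

/-- The number of `∗`-entries (free coordinates) of `p` among `0, …, r-1`. -/
def starCount (r : ℕ) (p : ℕ → Option ℕ) : ℕ :=
  ((Finset.range r).filter (fun i => p i = none)).card

/-- The 3-substitution of a tuple `p ∈ (ℤ≥0 ∪ {∗})^r` into `f`: substitute
`3^{kᵢ}` for `xᵢ` whenever `p i = some kᵢ`, renumbering the surviving variables
in increasing order. -/
noncomputable def subst3 (f : MvPolynomial ℕ ℤ) (p : ℕ → Option ℕ) : MvPolynomial ℕ ℤ :=
  MvPolynomial.aeval (fun j =>
    match p j with
    | some k => MvPolynomial.C ((3 : ℤ) ^ k)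
    | none => MvPolynomial.X (((Finset.range j).filter (fun i => p i = none)).card)) f

/-- The insertion map `ι` associated to `p`: inserts the arguments into the
coordinates of `p` equal to `∗`. -/
def iotaMap (p : ℕ → Option ℕ) (ℓ : ℕ → ℕ) : ℕ → ℕ := fun j =>
  match p j with
  | some k => k
  | none => ℓ (((Finset.range j).filter (fun i => p i = none)).card)

theorem CpxW.pos {n k : ℕ} (h : CpxW n k) : 0 < n ∧ 0 < k := by
  induction h with
  | one => simp
  | add _ _ iha ihb => omega
  | mul _ _ iha ihb => exact ⟨Nat.mul_pos iha.1 ihb.1, by omega⟩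

theorem CpxW.exists_of_pos {n : ℕ} (hn : 0 < n) : ∃ k, CpxW n k := by
  induction n, hn using Nat.le_induction with
  | base => exact ⟨1, .one⟩
  | succ n _ ih => exact ⟨_, ih.choose_spec.add .one⟩

theorem cpxW_cpx {n : ℕ} (hn : 0 < n) : CpxW n (cpx n) :=
  Nat.sInf_mem (CpxW.exists_of_pos hn)

theorem CpxW.cpx_le {n k : ℕ} (h : CpxW n k) : cpx n ≤ k := Nat.sInf_le h

theorem cpx_mul_le {a b : ℕ} (ha : 0 < a) (hb : 0 < b) : cpx (a * b) ≤ cpx a + cpx b :=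
  ((cpxW_cpx ha).mul (cpxW_cpx hb)).cpx_le

theorem add_one_pow_three_le {a m n : ℕ} (ha : 0 < a) (hm : 0 < m) (hn : 0 < n)
    (h : a ^ 3 ≤ 3 ^ m) : (a + 1) ^ 3 ≤ 3 ^ (m + n) := by
  have h3 : 3 ^ m * 3 ≤ 3 ^ (m + n) := by
    rw [← pow_succ]
    exact Nat.pow_le_pow_right (by norm_num) (by omega)
  obtain rfl | rfl | ha' : a = 1 ∨ a = 2 ∨ 3 ≤ a := by omega
  · calc (1 + 1) ^ 3 ≤ 3 ^ 2 := by norm_num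
      _ ≤ 3 ^ (m + n) := Nat.pow_le_pow_right (by norm_num) (by omega)
  · have hm2 : 2 ≤ m := by
      by_contra hlt
      obtain rfl : m = 1 := by omega
      norm_num at h
    calc (2 + 1) ^ 3 ≤ 3 ^ 3 := by norm_num
      _ ≤ 3 ^ (m + n) := Nat.pow_le_pow_right (by norm_num) (by omega)
  · have : (a + 1) ^ 3 ≤ a ^ 3 * 3 := by
      obtain ⟨t, rfl⟩ := Nat.exists_eq_add_of_le ha'
      ring_nf
      nlinarith [sq_nonneg t, Nat.zero_le (t ^ 3)]
    omega

theorem CpxW.pow_three_le {n k : ℕ} (h : CpxW n k) : n ^ 3 ≤ 3 ^ k := by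
  induction h with
  | one => norm_num
  | @add a b m n ha hb iha ihb =>
    have hap := ha.pos
    have hbp := hb.pos
    obtain rfl | ha2 : a = 1 ∨ 2 ≤ a := by omega
    · rw [add_comm 1, add_comm m]
      exact add_one_pow_three_le hbp.1 hbp.2 hap.2 ihb
    obtain rfl | hb2 : b = 1 ∨ 2 ≤ b := by omega
    · exact add_one_pow_three_le hap.1 hap.2 hbp.2 iha
    calc (a + b) ^ 3 ≤ (a * b) ^ 3 := Nat.pow_le_pow_left (Nat.add_le_mul ha2 hb2) 3
      _ = a ^ 3 * b ^ 3 := mul_pow ..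
      _ ≤ 3 ^ m * 3 ^ n := Nat.mul_le_mul iha ihb
      _ = 3 ^ (m + n) := (pow_add ..).symm
  | mul _ _ iha ihb =>
    rw [mul_pow, pow_add]
    exact Nat.mul_le_mul iha ihb

theorem defect_nonneg {n : ℕ} (hn : 0 < n) : 0 ≤ defect n := by
  have h : ((n : ℝ) ^ 3) ≤ 3 ^ cpx n := by exact_mod_cast (cpxW_cpx hn).pow_three_le
  have h' := Real.logb_le_logb_of_le (b := 3) (by norm_num) (by positivity) h
  rw [Real.logb_pow, Real.logb_pow, Real.logb_self_eq_one (by norm_num)] at h'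
  norm_num at h'
  simpa [defect] using h'

/-- Coefficients of a product of polynomials in disjoint sets of variables. -/
theorem MvPolynomial.coeff_add_mul_of_disjoint {σ R : Type*} [CommSemiring R]
    {f g : MvPolynomial σ R} {m n : σ →₀ ℕ} {S : Set σ}
    (hf : ∀ i ∈ f.vars, i ∈ S) (hg : ∀ i ∈ g.vars, i ∉ S)
    (hm : ∀ i ∉ S, m i = 0) (hn : ∀ i ∈ S, n i = 0) :
    coeff (m + n) (f * g) = coeff m f * coeff n g := by
  classical
  rw [coeff_mul]
  refine Finset.sum_eq_single (m, n) ?_ (fun h => absurd (by simp) h)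
  rintro ⟨p, q⟩ hpq hne
  rw [Finset.HasAntidiagonal.mem_antidiagonal] at hpq
  by_contra hmul
  have hp : p ∈ f.support := mem_support_iff.2 (left_ne_zero_of_mul hmul)
  have hq : q ∈ g.support := mem_support_iff.2 (right_ne_zero_of_mul hmul)
  have hp0 : ∀ i ∉ S, p i = 0 := fun i hi =>
    mem_support_notMem_vars_zero hp fun h => hi (hf i h)
  have hq0 : ∀ i ∈ S, q i = 0 := fun i hi =>
    mem_support_notMem_vars_zero hq fun h => hg i h hi
  have key : ∀ i, p i = m i ∧ q i = n i := fun i => by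
    have h : p i + q i = m i + n i := DFunLike.congr_fun hpq i
    by_cases hi : i ∈ S
    · have := hq0 i hi; have := hn i hi; omega
    · have := hp0 i hi; have := hm i hi; omega
  exact hne (Prod.ext (Finsupp.ext fun i => (key i).1) (Finsupp.ext fun i => (key i).2))

theorem sum_range_single_apply (r i : ℕ) :
    (∑ j ∈ Finset.range r, Finsupp.single j 1 : ℕ →₀ ℕ) i = if i < r then 1 else 0 := by
  simp [Finsupp.finsetSum_apply, Finsupp.single_apply]

theorem LDP.vars_lt {r C : ℕ} {f : MvPolynomial ℕ ℤ} (h : LDP r f C) :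
    ∀ i ∈ f.vars, i < r := by
  classical
  induction h with
  | const => simp only [MvPolynomial.vars_C, Finset.notMem_empty, false_imp_iff, implies_true]
  | @mul r₁ r₂ _ _ _ _ _ _ ih₁ ih₂ =>
    intro i hi
    rcases Finset.mem_union.1 (MvPolynomial.vars_mul _ _ hi) with h | h
    · have := ih₁ i h
      omega
    · obtain ⟨j, hj, rfl⟩ := Finset.mem_image.1 (MvPolynomial.vars_rename _ _ h)
      exact (Nat.add_lt_add_right (ih₂ j hj) r₁).trans_eq (add_comm _ _)
  | step c D _ _ _ ih =>
    intro i hi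
    rcases Finset.mem_union.1 (MvPolynomial.vars_add_subset _ _ hi) with h | h
    · rcases Finset.mem_union.1 (MvPolynomial.vars_mul _ _ h) with h | h
      · have := ih i h
        omega
      · simp only [MvPolynomial.vars_X, Finset.mem_singleton] at h
        omega
    · rw [MvPolynomial.vars_C] at h
      exact absurd h (Finset.notMem_empty i)

theorem leadCoeff_mul_rename {r₁ r₂ : ℕ} {f₁ f₂ : MvPolynomial ℕ ℤ}
    (h₁ : ∀ i ∈ f₁.vars, i < r₁) :
    leadCoeff (r₁ + r₂) (f₁ * MvPolynomial.rename (· + r₁) f₂) =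
      leadCoeff r₁ f₁ * leadCoeff r₂ f₂ := by
  classical
  have hsum : (∑ i ∈ Finset.range (r₁ + r₂), Finsupp.single i 1 : ℕ →₀ ℕ) =
      ∑ i ∈ Finset.range r₁, Finsupp.single i 1 +
        Finsupp.mapDomain (· + r₁) (∑ i ∈ Finset.range r₂, Finsupp.single i 1) := by
    simp [Finset.sum_range_add, Finsupp.mapDomain_finsetSum, Finsupp.mapDomain_single, add_comm]
  unfold leadCoeff
  rw [hsum, MvPolynomial.coeff_add_mul_of_disjoint (S := Set.Iio r₁) h₁,
    MvPolynomial.coeff_rename_mapDomain _ (add_left_injective r₁)]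
  · intro i hi
    obtain ⟨j, _, rfl⟩ := Finset.mem_image.1 (MvPolynomial.vars_rename _ _ hi)
    simp
  · intro i hi
    rw [sum_range_single_apply, if_neg (Set.notMem_Iio.1 hi).not_gt]
  · intro i hi
    apply Finsupp.mapDomain_of_notMem_range
    rintro ⟨j, rfl⟩
    simp at hi

theorem leadCoeff_mul_X_add_C (r : ℕ) (f : MvPolynomial ℕ ℤ) (c : ℤ) :
    leadCoeff (r + 1) (f * MvPolynomial.X r + MvPolynomial.C c) = leadCoeff r f := by
  classical
  unfold leadCoeff
  rw [MvPolynomial.coeff_add, MvPolynomial.coeff_C, if_neg, add_zero, Finset.sum_range_succ,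
    MvPolynomial.coeff_mul_X]
  intro h
  have := DFunLike.congr_fun h r
  rw [sum_range_single_apply] at this
  simp at this

theorem LDP.exists_leadCoeff {r C : ℕ} {f : MvPolynomial ℕ ℤ} (h : LDP r f C) :
    ∃ a : ℕ, 0 < a ∧ leadCoeff r f = a ∧ cpx a + r ≤ C := by
  induction h with
  | const k C hk hC => exact ⟨k, hk, MvPolynomial.coeff_zero_C _, hC⟩
  | mul h₁ _ ih₁ ih₂ =>
    obtain ⟨a, ha, hla, hCa⟩ := ih₁
    obtain ⟨b, hb, hlb, hCb⟩ := ih₂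
    refine ⟨a * b, Nat.mul_pos ha hb, ?_, ?_⟩
    · rw [leadCoeff_mul_rename h₁.vars_lt, hla, hlb, Nat.cast_mul]
    · have := cpx_mul_le ha hb
      omega
  | step c D hc hD _ ih =>
    obtain ⟨a, ha, hla, hCa⟩ := ih
    refine ⟨a, ha, by rw [leadCoeff_mul_X_add_C, hla], ?_⟩
    have := (cpxW_cpx hc).pos.2
    omega

/-- For a low-defect pair `(f,C)` of degree `k` with leading
coefficient `a`, `δ(f,C) ≥ δ(a) + k ≥ k`. -/
theorem pair_dft_lower_bound (k : ℕ) (f : MvPolynomial ℕ ℤ) (C : ℕ) (hf : LDP k f C)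
    (a : ℕ) (ha : leadCoeff k f = (a : ℤ)) :
    defect a + k ≤ pairDft k f C ∧ (k : ℝ) ≤ defect a + k := by
  obtain ⟨b, hb, hlb, hC⟩ := hf.exists_leadCoeff
  obtain rfl : b = a := by exact_mod_cast hlb.symm.trans ha
  refine ⟨?_, by linarith [defect_nonneg hb]⟩
  have hC' : (cpx b : ℝ) + k ≤ C := by exact_mod_cast hC
  rw [pairDft, defect, ha, Int.cast_natCast]
  linarith
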